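/- For each l ≥ 2, the function λ ↦ λ² / α_l(λ)^{1/2} = λ² / √(log(e + α_{l-1}(λ))) is convex on [0,∞). -/

import Mathlib

/-- The iterated-logarithm hierarchy: `iterLog α 0 = α`,
`iterLog α (l+1) = log (e + iterLog α l)`. -/
noncomputable def iterLog (α : ℝ → ℝ) : ℕ → ℝ → ℝ
  | 0 => α
  | l + 1 => fun x => Real.log (Real.exp 1 + iterLog α l x)

theorem ConcaveOn.log_comp {s : Set ℝ} {g : ℝ → ℝ} (hg : ConcaveOn ℝ s g)
    (hpos : ∀ x ∈ s, 0 < g x) : ConcaveOn ℝ s (fun x => Real.log (g x)) := by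
  refine ⟨hg.1, fun x hx y hy a b ha hb hab => ?_⟩
  have hcomb := convex_Ioi (0 : ℝ) (hpos x hx) (hpos y hy) ha hb hab
  exact (strictConcaveOn_log_Ioi.concaveOn.2 (hpos x hx) (hpos y hy) ha hb hab).trans
    (Real.log_le_log hcomb (hg.2 hx hy ha hb hab))

theorem ConcaveOn.sqrt_comp {s : Set ℝ} {g : ℝ → ℝ} (hg : ConcaveOn ℝ s g)
    (hpos : ∀ x ∈ s, 0 ≤ g x) : ConcaveOn ℝ s (fun x => Real.sqrt (g x)) := by
  refine ⟨hg.1, fun x hx y hy a b ha hb hab => ?_⟩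
  exact (Real.strictConcaveOn_sqrt.concaveOn.2 (hpos x hx) (hpos y hy) ha hb hab).trans
    (Real.sqrt_le_sqrt (hg.2 hx hy ha hb hab))

/-- The square of the variable divided by a positive concave function is convex. -/
theorem ConcaveOn.convexOn_sq_div {s : Set ℝ} {g : ℝ → ℝ} (hg : ConcaveOn ℝ s g)
    (hpos : ∀ x ∈ s, 0 < g x) : ConvexOn ℝ s (fun x => x ^ 2 / g x) := by
  have tangent : ∀ x ∈ s, ∀ t : ℝ, 2 * t * x - t ^ 2 * g x ≤ x ^ 2 / g x := fun x hx t => by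
    rw [le_div_iff₀ (hpos x hx)]
    nlinarith [sq_nonneg (x - t * g x)]
  refine ⟨hg.1, fun x hx y hy a b ha hb hab => ?_⟩
  have hz := hg.1 hx hy ha hb hab
  have hconc := hg.2 hx hy ha hb hab
  simp only [smul_eq_mul] at hz hconc ⊢
  set z := a * x + b * y with hzdef
  set t := z / g z with ht
  have heq : z ^ 2 / g z = 2 * t * z - t ^ 2 * g z := by
    have := (hpos z hz).ne'
    rw [ht]
    field_simp
    ring
  have h1 := mul_le_mul_of_nonneg_left (tangent x hx t) ha
  have h2 := mul_le_mul_of_nonneg_left (tangent y hy t) hb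
  have h3 := mul_le_mul_of_nonneg_left hconc (sq_nonneg t)
  have h4 : 2 * t * z = a * (2 * t * x) + b * (2 * t * y) := by rw [hzdef]; ring
  rw [heq]
  linarith

theorem one_le_iterLog {α : ℝ → ℝ} {s : Set ℝ} (h : ∀ x ∈ s, 1 ≤ α x) (l : ℕ) :
    ∀ x ∈ s, 1 ≤ iterLog α l x := by
  induction l with
  | zero => exact h
  | succ l ih =>
    intro x hx
    have := ih x hx
    have he := Real.exp_pos 1
    change 1 ≤ Real.log (Real.exp 1 + iterLog α l x)
    rw [Real.le_log_iff_exp_le (by linarith)]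
    linarith

theorem ConcaveOn.iterLog {α : ℝ → ℝ} {s : Set ℝ} (hα : ConcaveOn ℝ s α)
    (h : ∀ x ∈ s, 1 ≤ α x) (l : ℕ) : ConcaveOn ℝ s (iterLog α l) := by
  induction l with
  | zero => exact hα
  | succ l ih =>
    refine ConcaveOn.log_comp ((concaveOn_const (Real.exp 1) ih.1).add ih) fun x hx => ?_
    have := one_le_iterLog h l x hx
    have := Real.exp_pos 1
    change 0 < Real.exp 1 + _root_.iterLog α l x
    linarith

/-- convexity of `λ ↦ λ² / α_l(λ)^{1/2}` for `l ≥ 2`. -/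
theorem stmt_12 (α : ℝ → ℝ) (c : ℝ) (hc : 0 < c)
    (hd1 : Differentiable ℝ α)
    (hd2 : Differentiable ℝ (deriv α))
    (hmono : MonotoneOn α (Set.Ici 0))
    (hconc : ConcaveOn ℝ (Set.Ici 0) α)
    (h0 : 1 ≤ α 0)
    (htend : Filter.Tendsto α Filter.atTop Filter.atTop)
    (hder : ∀ x : ℝ, 0 ≤ x → deriv α x ≤ α x / (1 + x))
    (hder2 : ∀ x : ℝ, 0 ≤ x → -(c / (1 + x)) ≤ deriv (deriv α) x) :
    ∀ l : ℕ, 2 ≤ l →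
      ConvexOn ℝ (Set.Ici 0) (fun lam => lam ^ 2 / Real.sqrt (iterLog α l lam)) := by
  intro l _
  have hα : ∀ x ∈ Set.Ici (0 : ℝ), 1 ≤ α x := fun x hx =>
    h0.trans (hmono Set.self_mem_Ici hx hx)
  have hpos : ∀ x ∈ Set.Ici (0 : ℝ), 0 < iterLog α l x := fun x hx =>
    one_pos.trans_le (one_le_iterLog hα l x hx)
  exact ((hconc.iterLog hα l).sqrt_comp fun x hx => (hpos x hx).le).convexOn_sq_div
    fun x hx => Real.sqrt_pos.2 (hpos x hx)
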